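/- Let μ, ν be compactly supported, atomless Borel probability measures on ℝ, λ_C := W∞(μ,ν), γ̄ an ∞-cyclically monotone optimal plan and γ any optimal plan. Then for every x̄ ∈ M_γ̄^+, the quarter of plane Q := [x̄, +∞) × (−∞, x̄+λ_C] satisfies γ(Q) = 0. -/

import Mathlib

open MeasureTheory Set Filter Topology
open scoped ENNReal NNReal

noncomputable section

/-- Topological support of a measure: points all of whose open neighborhoods have
positive measure. -/
def mSupport {α : Type*} [TopologicalSpace α] [MeasurableSpace α] (γ : Measure α) : Set α :=
  {x | ∀ U : Set α, IsOpen U → x ∈ U → 0 < γ U}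

/-- γ is a transport plan (coupling) between μ and ν. -/
def IsCoupling {α : Type*} [MeasurableSpace α] (μ ν : Measure α) (γ : Measure (α × α)) : Prop :=
  γ.fst = μ ∧ γ.snd = ν

/-- The γ-essential supremum of the distance |x - y|. -/
def costInf {α : Type*} [MeasurableSpace α] [PseudoEMetricSpace α]
    (γ : Measure (α × α)) : ℝ≥0∞ :=
  essSup (fun p => edist p.1 p.2) γ

/-- The L^∞ optimal transport cost W∞(μ, ν). -/
def Winfty {α : Type*} [MeasurableSpace α] [PseudoEMetricSpace α] (μ ν : Measure α) : ℝ≥0∞ :=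
  ⨅ (γ : Measure (α × α)) (_ : IsCoupling μ ν γ), costInf γ

/-- γ is an optimal plan for the L^∞ optimal transport problem. -/
def IsOptimalPlan {α : Type*} [MeasurableSpace α] [PseudoEMetricSpace α]
    (μ ν : Measure α) (γ : Measure (α × α)) : Prop :=
  IsCoupling μ ν γ ∧ costInf γ = Winfty μ ν

/-- μ is compactly supported. -/
def CompactlySupported {α : Type*} [TopologicalSpace α] [MeasurableSpace α]
    (μ : Measure α) : Prop :=
  ∃ K : Set α, IsCompact K ∧ μ Kᶜ = 0

/-- The admissible class U_λ of the dual problem. -/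
def DualAdm {α : Type*} [MeasurableSpace α] [PseudoMetricSpace α]
    (μ ν : Measure α) (lam : ℝ) (φ ψ : α → ℝ) : Prop :=
  Integrable φ μ ∧ Integrable ψ ν ∧
    ∀ᵐ x ∂μ, ∀ᵐ y ∂ν, dist x y ≤ lam → φ x + ψ y ≤ 0

/-- ∞-cyclical monotonicity of a plan on ℝ. -/
def InfCM (γ : Measure (ℝ × ℝ)) : Prop :=
  ∀ (n : ℕ) (p : Fin (n + 1) → ℝ × ℝ), (∀ i, p i ∈ mSupport γ) →
    (⨆ i, |(p i).1 - (p i).2|) ≤ ⨆ i, |(p i).1 - (p (i + 1)).2|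

/-- Points moved at maximal distance to the right. -/
def Mplus (γ : Measure (ℝ × ℝ)) (lam : ℝ) : Set ℝ := {x | (x, x + lam) ∈ mSupport γ}

/-- Points moved at maximal distance to the left. -/
def Mminus (γ : Measure (ℝ × ℝ)) (lam : ℝ) : Set ℝ := {x | (x, x - lam) ∈ mSupport γ}


theorem IsCoupling.measure_fst_preimage {α : Type*} [MeasurableSpace α] {μ ν : Measure α}
    {γ : Measure (α × α)} (h : IsCoupling μ ν γ) {s : Set α} (hs : MeasurableSet s) :
    γ (Prod.fst ⁻¹' s) = μ s := by
  rw [← h.1, Measure.fst_apply hs]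

theorem IsCoupling.measure_snd_preimage {α : Type*} [MeasurableSpace α] {μ ν : Measure α}
    {γ : Measure (α × α)} (h : IsCoupling μ ν γ) {s : Set α} (hs : MeasurableSet s) :
    γ (Prod.snd ⁻¹' s) = ν s := by
  rw [← h.2, Measure.snd_apply hs]

theorem Winfty_ne_top {α : Type*} [MeasurableSpace α] [PseudoMetricSpace α] {μ ν : Measure α}
    [IsProbabilityMeasure μ] [IsProbabilityMeasure ν]
    (hμ : CompactlySupported μ) (hν : CompactlySupported ν) : Winfty μ ν ≠ ⊤ := by
  obtain ⟨K, hK, hK0⟩ := hμ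
  obtain ⟨L, hL, hL0⟩ := hν
  have hKL : Bornology.IsBounded (K ∪ L) := (hK.union hL).isBounded
  have hcoupling : IsCoupling μ ν (μ.prod ν) := ⟨by simp, by simp⟩
  refine ne_top_of_le_ne_top hKL.ediam_ne_top ((iInf₂_le _ hcoupling).trans ?_)
  refine essSup_le_of_ae_le _ ?_
  have h1 : ∀ᵐ p ∂μ.prod ν, p.1 ∈ K := Measure.quasiMeasurePreserving_fst.ae hK0
  have h2 : ∀ᵐ p ∂μ.prod ν, p.2 ∈ L := Measure.quasiMeasurePreserving_snd.ae hL0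
  filter_upwards [h1, h2] with p hp1 hp2
  exact Metric.edist_le_ediam_of_mem (Or.inl hp1) (Or.inr hp2)

theorem IsOptimalPlan.ae_abs_sub_le {μ ν : Measure ℝ} {γ : Measure (ℝ × ℝ)}
    (h : IsOptimalPlan μ ν γ) (hW : Winfty μ ν ≠ ⊤) :
    ∀ᵐ p ∂γ, |p.1 - p.2| ≤ (Winfty μ ν).toReal := by
  have hle : ∀ᵐ p ∂γ, edist p.1 p.2 ≤ Winfty μ ν := by
    rw [← h.2]
    exact ENNReal.ae_le_essSup _
  filter_upwards [hle] with p hp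
  rw [← Real.dist_eq, ← ENNReal.toReal_ofReal (dist_nonneg (x := p.1) (y := p.2)), ← edist_dist]
  exact ENNReal.toReal_mono hW hp

/-- A coupling with displacement at most `r` fills `Ici x ×ˢ Iic (x + r)` with exactly the mass
of `Iic (x + r)` that cannot come from `Iio x`. -/
theorem IsCoupling.measure_Iio_add_quarter {μ ν : Measure ℝ} {γ : Measure (ℝ × ℝ)} {r : ℝ}
    (h : IsCoupling μ ν γ) (hr : ∀ᵐ p ∂γ, |p.1 - p.2| ≤ r) (x : ℝ) :
    μ (Iio x) + γ (Ici x ×ˢ Iic (x + r)) = ν (Iic (x + r)) := by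
  rw [← h.measure_fst_preimage measurableSet_Iio, ← h.measure_snd_preimage measurableSet_Iic,
    ← measure_union _ (measurableSet_Ici.prod measurableSet_Iic)]
  · refine measure_congr ?_
    filter_upwards [hr] with p hp
    have := abs_le.1 hp
    refine propext ⟨?_, fun hp2 => ?_⟩
    · rintro (hp1 | hp1)
      · have hp1 : p.1 < x := hp1
        change p.2 ≤ x + r
        linarith
      · exact hp1.2
    · rcases lt_or_ge p.1 x with hp1 | hp1
      · exact Or.inl hp1
      · exact Or.inr ⟨hp1, hp2⟩
  · refine Set.disjoint_left.2 fun p hp1 hp2 => ?_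
    exact lt_irrefl x (lt_of_le_of_lt hp2.1 hp1)

theorem InfCM.le_max_swap {γ : Measure (ℝ × ℝ)} (h : InfCM γ) {p q : ℝ × ℝ}
    (hp : p ∈ mSupport γ) (hq : q ∈ mSupport γ) :
    |p.1 - p.2| ≤ max |p.1 - q.2| |q.1 - p.2| := by
  have hpq := h 1 ![p, q] (fun i => by fin_cases i <;> assumption)
  refine ((le_ciSup (f := fun i => |(![p, q] i).1 - (![p, q] i).2|)
    (Set.finite_range _).bddAbove 0).trans hpq).trans (ciSup_le fun i => ?_)
  fin_cases i
  · exact le_max_left _ _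
  · exact le_max_right _ _

theorem InfCM.measure_quarter_eq_zero {μ ν : Measure ℝ} [NullSingletonClass μ]
    [NullSingletonClass ν] {γ : Measure (ℝ × ℝ)} {r x : ℝ} (hcm : InfCM γ)
    (h : IsCoupling μ ν γ) (hr : ∀ᵐ p ∂γ, |p.1 - p.2| ≤ r) (hx : x ∈ Mplus γ r) :
    γ (Ici x ×ˢ Iic (x + r)) = 0 := by
  by_contra hne
  have hfst : ∀ᵐ p ∂γ, p.1 ≠ x := by
    have := h.measure_fst_preimage (measurableSet_singleton x)
    rw [measure_singleton] at this
    exact measure_eq_zero_iff_ae_notMem.1 this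
  have hsnd : ∀ᵐ p ∂γ, p.2 ≠ x + r := by
    have := h.measure_snd_preimage (measurableSet_singleton (x + r))
    rw [measure_singleton] at this
    exact measure_eq_zero_iff_ae_notMem.1 this
  have hpos : γ ((Ioi x ×ˢ Iio (x + r)) ∩ {p | |p.1 - p.2| ≤ r}) ≠ 0 := by
    rw [← pos_iff_ne_zero]
    refine (pos_iff_ne_zero.2 hne).trans_le (measure_mono_ae ?_)
    filter_upwards [hfst, hsnd, hr] with p hp1 hp2 hp hpQ
    exact ⟨⟨lt_of_le_of_ne hpQ.1 hp1.symm, lt_of_le_of_ne hpQ.2 hp2⟩, hp⟩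
  obtain ⟨q, ⟨⟨hq1, hq2⟩, hq⟩, hqpos⟩ := exists_mem_forall_mem_nhdsWithin_pos_measure hpos
  have hqs : q ∈ mSupport γ := fun U hU hqU =>
    hqpos U (mem_nhdsWithin_of_mem_nhds (hU.mem_nhds hqU))
  have hle := hcm.le_max_swap (show (x, x + r) ∈ mSupport γ from hx) hqs
  simp only [mem_Ioi, mem_Iio] at hq1 hq2
  have hq' := abs_le.1 (show |q.1 - q.2| ≤ r from hq)
  have hlt : max |x - q.2| |q.1 - (x + r)| < r :=
    max_lt (abs_lt.2 ⟨by linarith, by linarith⟩) (abs_lt.2 ⟨by linarith, by linarith⟩)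
  have hr0 : r ≤ |x - (x + r)| := by
    rw [sub_add_cancel_left, abs_neg]
    exact le_abs_self r
  exact absurd (hr0.trans hle) (not_le.2 hlt)

/-- For every x̄ ∈ M_γ̄⁺, the quarter of plane [x̄, +∞) × (−∞, x̄ + λ_C] has zero mass
for every optimal plan γ. -/
theorem quarter_plane_null (μ ν : Measure ℝ)
    [IsProbabilityMeasure μ] [IsProbabilityMeasure ν] [NullSingletonClass μ] [NullSingletonClass ν]
    (hμ : CompactlySupported μ) (hν : CompactlySupported ν)
    (γ γbar : Measure (ℝ × ℝ)) (hγ : IsOptimalPlan μ ν γ)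
    (hγbar : IsOptimalPlan μ ν γbar) (hcm : InfCM γbar) :
    ∀ x₀ ∈ Mplus γbar (Winfty μ ν).toReal,
      γ (Set.Ici x₀ ×ˢ Set.Iic (x₀ + (Winfty μ ν).toReal)) = 0 := by
  intro x₀ hx₀
  have hW := Winfty_ne_top hμ hν
  have hr := hγ.ae_abs_sub_le hW
  have hrbar := hγbar.ae_abs_sub_le hW
  have heq := (hγ.1.measure_Iio_add_quarter hr x₀).trans
    (hγbar.1.measure_Iio_add_quarter hrbar x₀).symm
  rw [ENNReal.add_right_inj (measure_ne_top μ _)] at heq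
  rw [heq]
  exact hcm.measure_quarter_eq_zero hγbar.1 hrbar hx₀

end
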